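/- arXiv:2604.09699 — 3 statements merged into one kernel-verified Lean document; each statement's English description precedes it below -/
import Mathlib

section
/- Let θ be any positive number with θ < (1 - A)/(A·U·(l_p + l_p̃) + A·Ũ·(l_q + l_q̃) + (l_r + l_r̃)), and define the metric ρ_θ on ℝ³ by ρ_θ((x₁,y₁,z₁),(x₂,y₂,z₂)) = |x₁ - x₂| + θ(|y₁ - y₂| + |z₁ - z₂|). Then ρ_θ is Lipschitz-equivalent to the Euclidean metric on ℝ³, and every map ω_i : I × E → I × E (i = 1,…,n) is a contraction with respect to ρ_θ: ρ_θ(ω_i(P), ω_i(Q)) ≤ κ·ρ_θ(P,Q) for all P,Q ∈ I × E, where κ = max{A + θ(A·U·(l_p + l_p̃) + A·Ũ·(l_q + l_q̃) + (l_r + l_r̃)), S̄} < 1. -/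
open Set

namespace ZHV

noncomputable section

variable {n : ℕ}

/-- Index `i-1+ε_i` (image of `x₀` under `L_i`). -/
def e0 (ε : Fin n → Bool) (i : Fin n) : Fin (n + 1) :=
  if ε i then i.succ else i.castSucc

/-- Index `i-ε_i` (image of `x_n` under `L_i`). -/
def e1 (ε : Fin n → Bool) (i : Fin n) : Fin (n + 1) :=
  if ε i then i.castSucc else i.succ

/-- The interval `I = [x₀, x_n]`. -/
def Ifull (X : Fin (n + 1) → ℝ) : Set ℝ := Icc (X 0) (X (Fin.last n))

/-- The subinterval `I_i = [x_{i-1}, x_i]`. -/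
def Isub (X : Fin (n + 1) → ℝ) (i : Fin n) : Set ℝ := Icc (X i.castSucc) (X i.succ)

def acoef (X : Fin (n + 1) → ℝ) (ε : Fin n → Bool) (i : Fin n) : ℝ :=
  (X (e1 ε i) - X (e0 ε i)) / (X (Fin.last n) - X 0)

def bcoef (X : Fin (n + 1) → ℝ) (ε : Fin n → Bool) (i : Fin n) : ℝ :=
  (X (e0 ε i) * X (Fin.last n) - X (e1 ε i) * X 0) / (X (Fin.last n) - X 0)

/-- `L_i(t) = a_i t + b_i`. -/
def Lmap (X : Fin (n + 1) → ℝ) (ε : Fin n → Bool) (i : Fin n) (t : ℝ) : ℝ :=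
  acoef X ε i * t + bcoef X ε i

/-- `L_i⁻¹`. -/
def Linv (X : Fin (n + 1) → ℝ) (ε : Fin n → Bool) (i : Fin n) (t : ℝ) : ℝ :=
  (t - bcoef X ε i) / acoef X ε i

/-- `μ(t) = (t - x₀)/(x_n - x₀)`. -/
def mu (X : Fin (n + 1) → ℝ) (t : ℝ) : ℝ := (t - X 0) / (X (Fin.last n) - X 0)

/-- The affine function through `(x₀, w₀)` and `(x_n, w_n)`:
`μ(t)·w_n + (1-μ(t))·w₀`. -/
def base (X W : Fin (n + 1) → ℝ) (t : ℝ) : ℝ :=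
  mu X t * W (Fin.last n) + (1 - mu X t) * W 0

/-- `F_{i,1}`. -/
def F1 (X Y Z : Fin (n + 1) → ℝ) (ε : Fin n → Bool) (p q : Fin n → ℝ → ℝ)
    (i : Fin n) (t yv zv : ℝ) : ℝ :=
  p i (Lmap X ε i t) * (yv - base X Y t) + q i (Lmap X ε i t) * (zv - base X Z t)
    + (mu X t * Y (e1 ε i) + (1 - mu X t) * Y (e0 ε i))

/-- `F_{i,2}`. -/
def F2 (X Y Z : Fin (n + 1) → ℝ) (ε : Fin n → Bool) (pt qt : Fin n → ℝ → ℝ)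
    (i : Fin n) (t yv zv : ℝ) : ℝ :=
  pt i (Lmap X ε i t) * (yv - base X Y t) + qt i (Lmap X ε i t) * (zv - base X Z t)
    + (mu X t * Z (e1 ε i) + (1 - mu X t) * Z (e0 ε i))

/-- `ω_i(x,y,z) = (L_i(x), F_{i,1}(x,y,z), F_{i,2}(x,y,z))`. -/
def wmap (X Y Z : Fin (n + 1) → ℝ) (ε : Fin n → Bool) (p q pt qt : Fin n → ℝ → ℝ)
    (i : Fin n) (P : ℝ × ℝ × ℝ) : ℝ × ℝ × ℝ :=
  (Lmap X ε i P.1, F1 X Y Z ε p q i P.1 P.2.1 P.2.2, F2 X Y Z ε pt qt i P.1 P.2.1 P.2.2)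

/-- `r_i`. -/
def rmap (X Y Z : Fin (n + 1) → ℝ) (ε : Fin n → Bool) (p q : Fin n → ℝ → ℝ)
    (i : Fin n) (t : ℝ) : ℝ :=
  (mu X t * Y (e1 ε i) + (1 - mu X t) * Y (e0 ε i))
    - p i (Lmap X ε i t) * base X Y t - q i (Lmap X ε i t) * base X Z t

/-- `r̃_i`. -/
def rtmap (X Y Z : Fin (n + 1) → ℝ) (ε : Fin n → Bool) (pt qt : Fin n → ℝ → ℝ)
    (i : Fin n) (t : ℝ) : ℝ :=
  (mu X t * Z (e1 ε i) + (1 - mu X t) * Z (e0 ε i))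
    - pt i (Lmap X ε i t) * base X Y t - qt i (Lmap X ε i t) * base X Z t

/-- Sup norm of `g` on the subinterval `I_i`. -/
def snormSub (X : Fin (n + 1) → ℝ) (i : Fin n) (g : ℝ → ℝ) : ℝ :=
  sSup ((fun t => |g t|) '' Isub X i)

/-- Sup norm of `g` on `I`. -/
def snormFull (X : Fin (n + 1) → ℝ) (g : ℝ → ℝ) : ℝ :=
  sSup ((fun t => |g t|) '' Ifull X)

/-- The constant `U`. -/
def Uval (X Y Z : Fin (n + 1) → ℝ) (ε : Fin n → Bool) (p q pt qt : Fin n → ℝ → ℝ) : ℝ :=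
  ⨆ i : Fin n,
    (snormSub X i (q i) * snormFull X (rtmap X Y Z ε pt qt i)
        + (1 - snormSub X i (qt i)) * snormFull X (rmap X Y Z ε p q i)) /
      ((1 - snormSub X i (p i)) * (1 - snormSub X i (qt i))
        - snormSub X i (pt i) * snormSub X i (q i))

/-- The constant `Ũ`. -/
def Utval (X Y Z : Fin (n + 1) → ℝ) (ε : Fin n → Bool) (p q pt qt : Fin n → ℝ → ℝ) : ℝ :=
  ⨆ i : Fin n,
    (snormSub X i (pt i) * snormFull X (rmap X Y Z ε p q i)
        + (1 - snormSub X i (p i)) * snormFull X (rtmap X Y Z ε pt qt i)) /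
      ((1 - snormSub X i (p i)) * (1 - snormSub X i (qt i))
        - snormSub X i (pt i) * snormSub X i (q i))

/-- The set `E = [-U,U] × [-Ũ,Ũ]`. -/
def Eset (X Y Z : Fin (n + 1) → ℝ) (ε : Fin n → Bool) (p q pt qt : Fin n → ℝ → ℝ) :
    Set (ℝ × ℝ) :=
  Icc (-(Uval X Y Z ε p q pt qt)) (Uval X Y Z ε p q pt qt) ×ˢ
    Icc (-(Utval X Y Z ε p q pt qt)) (Utval X Y Z ε p q pt qt)

/-- `S̄ = max_i max{‖p_i‖+‖p̃_i‖, ‖q_i‖+‖q̃_i‖}`. -/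
def Sbar (X : Fin (n + 1) → ℝ) (p q pt qt : Fin n → ℝ → ℝ) : ℝ :=
  ⨆ i : Fin n,
    max (snormSub X i (p i) + snormSub X i (pt i))
      (snormSub X i (q i) + snormSub X i (qt i))

/-- Minimum value of `g` on `I_i`. -/
def fmin (X : Fin (n + 1) → ℝ) (i : Fin n) (g : ℝ → ℝ) : ℝ := sInf (g '' Isub X i)

/-- Maximum value of `g` on `I_i`. -/
def fmax (X : Fin (n + 1) → ℝ) (i : Fin n) (g : ℝ → ℝ) : ℝ := sSup (g '' Isub X i)

/-- The constant `M` of Section 4. -/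
def Mval (X Y Z : Fin (n + 1) → ℝ) (p q pt qt : Fin n → ℝ → ℝ) : ℝ :=
  ((⨆ j, Y j) + (⨆ j, Z j)
      - (⨆ i : Fin n, (max (snormSub X i (p i)) (snormSub X i (q i))
          + max (snormSub X i (pt i)) (snormSub X i (qt i))))
        * (min (Y 0) (Y (Fin.last n)) + min (Z 0) (Z (Fin.last n)))) /
    (1 - ⨆ i : Fin n, (max (snormSub X i (p i)) (snormSub X i (q i))
        + max (snormSub X i (pt i)) (snormSub X i (qt i))))

/-- The slope `m_i = (y_i - y_{i-1})/(x_i - x_{i-1})`. -/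
def mslope (X Y : Fin (n + 1) → ℝ) (i : Fin n) : ℝ :=
  (Y i.succ - Y i.castSucc) / (X i.succ - X i.castSucc)

/-- The standing hypotheses: the `x_i` are strictly increasing, the vertical scaling
factors are Lipschitz on `I_i` and satisfy `‖p_i‖+‖p̃_i‖ < 1` and `‖q_i‖+‖q̃_i‖ < 1`. -/
def Hyps (X : Fin (n + 1) → ℝ) (p q pt qt : Fin n → ℝ → ℝ) : Prop :=
  StrictMono X ∧
  (∀ i, ∃ K : NNReal, LipschitzOnWith K (p i) (Isub X i)) ∧
  (∀ i, ∃ K : NNReal, LipschitzOnWith K (pt i) (Isub X i)) ∧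
  (∀ i, ∃ K : NNReal, LipschitzOnWith K (q i) (Isub X i)) ∧
  (∀ i, ∃ K : NNReal, LipschitzOnWith K (qt i) (Isub X i)) ∧
  (∀ i, snormSub X i (p i) + snormSub X i (pt i) < 1) ∧
  (∀ i, snormSub X i (q i) + snormSub X i (qt i) < 1)

/-- `(f₁,f₂)` is a fixed point of the Read operator `T` on `C₀²(I)`:
it belongs to `C₀²(I)` and satisfies `f(x) = F_i(L_i⁻¹(x), f(L_i⁻¹(x)))` on each `I_i`. -/
def IsFixedPt (X Y Z : Fin (n + 1) → ℝ) (ε : Fin n → Bool)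
    (p q pt qt : Fin n → ℝ → ℝ) (f1 f2 : ℝ → ℝ) : Prop :=
  ContinuousOn f1 (Ifull X) ∧ ContinuousOn f2 (Ifull X) ∧
  f1 (X 0) = Y 0 ∧ f2 (X 0) = Z 0 ∧
  f1 (X (Fin.last n)) = Y (Fin.last n) ∧ f2 (X (Fin.last n)) = Z (Fin.last n) ∧
  ∀ i : Fin n, ∀ t ∈ Isub X i,
    f1 t = F1 X Y Z ε p q i (Linv X ε i t) (f1 (Linv X ε i t)) (f2 (Linv X ε i t)) ∧
    f2 t = F2 X Y Z ε pt qt i (Linv X ε i t) (f1 (Linv X ε i t)) (f2 (Linv X ε i t))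

/-- The graph `{(x, f₁(x), f₂(x)) : x ∈ I}`. -/
def Graph (X : Fin (n + 1) → ℝ) (f1 f2 : ℝ → ℝ) : Set (ℝ × ℝ × ℝ) :=
  (fun t => (t, f1 t, f2 t)) '' Ifull X

/-- The metric `ρ_θ`. -/
def rho (θ : ℝ) (P Q : ℝ × ℝ × ℝ) : ℝ :=
  |P.1 - Q.1| + θ * (|P.2.1 - Q.2.1| + |P.2.2 - Q.2.2|)

/-- The Euclidean distance on `ℝ³`. -/
def euclDist (P Q : ℝ × ℝ × ℝ) : ℝ :=
  Real.sqrt ((P.1 - Q.1) ^ 2 + (P.2.1 - Q.2.1) ^ 2 + (P.2.2 - Q.2.2) ^ 2)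

end

end ZHV

open ZHV Set

namespace ZHV

variable {n : ℕ} {X Y Z : Fin (n + 1) → ℝ} {ε : Fin n → Bool} {p q pt qt : Fin n → ℝ → ℝ}

theorem snormSub_nonneg (i : Fin n) (g : ℝ → ℝ) : 0 ≤ snormSub X i g :=
  Real.sSup_nonneg (by rintro _ ⟨t, _, rfl⟩; exact abs_nonneg _)

theorem snormFull_nonneg (g : ℝ → ℝ) : 0 ≤ snormFull X g :=
  Real.sSup_nonneg (by rintro _ ⟨t, _, rfl⟩; exact abs_nonneg _)

theorem abs_le_snormSub {i : Fin n} {g : ℝ → ℝ} (hg : ContinuousOn g (Isub X i)) {t : ℝ}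
    (ht : t ∈ Isub X i) : |g t| ≤ snormSub X i g :=
  le_csSup (isCompact_Icc.image_of_continuousOn hg.abs).bddAbove ⟨t, ht, rfl⟩

theorem one_sub_mul_one_sub_nonneg {a b c d : ℝ} (hb : 0 ≤ b) (hc : 0 ≤ c) (hab : a + b < 1)
    (hcd : c + d < 1) : 0 ≤ (1 - a) * (1 - d) - b * c := by
  nlinarith [mul_nonneg hb (show 0 ≤ 1 - d - c by linarith),
    mul_nonneg (show 0 ≤ 1 - a - b by linarith) (show 0 ≤ 1 - d by linarith)]

theorem Hyps.Uval_nonneg (h : Hyps X p q pt qt) : 0 ≤ Uval X Y Z ε p q pt qt := by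
  obtain ⟨-, -, -, -, -, hp, hq⟩ := h
  refine Real.iSup_nonneg fun i => div_nonneg (add_nonneg
    (mul_nonneg (snormSub_nonneg i _) (snormFull_nonneg _))
    (mul_nonneg ?_ (snormFull_nonneg _)))
    (one_sub_mul_one_sub_nonneg (snormSub_nonneg i _) (snormSub_nonneg i _) (hp i) (hq i))
  linarith [hq i, snormSub_nonneg (X := X) i (q i)]

theorem Hyps.Utval_nonneg (h : Hyps X p q pt qt) : 0 ≤ Utval X Y Z ε p q pt qt := by
  obtain ⟨-, -, -, -, -, hp, hq⟩ := h
  refine Real.iSup_nonneg fun i => div_nonneg (add_nonneg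
    (mul_nonneg (snormSub_nonneg i _) (snormFull_nonneg _))
    (mul_nonneg ?_ (snormFull_nonneg _)))
    (one_sub_mul_one_sub_nonneg (snormSub_nonneg i _) (snormSub_nonneg i _) (hp i) (hq i))
  linarith [hp i, snormSub_nonneg (X := X) i (pt i)]

theorem Lmap_eq (h : X 0 < X (Fin.last n)) (i : Fin n) (t : ℝ) :
    Lmap X ε i t = mu X t * X (e1 ε i) + (1 - mu X t) * X (e0 ε i) := by
  have : X (Fin.last n) - X 0 ≠ 0 := by linarith
  unfold Lmap acoef bcoef mu
  field_simp
  ring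

theorem Lmap_mem_Isub (hX : StrictMono X) (i : Fin n) {t : ℝ} (ht : t ∈ Ifull X) :
    Lmap X ε i t ∈ Isub X i := by
  have hi : X i.castSucc < X i.succ := hX (Fin.castSucc_lt_succ)
  have h : X 0 < X (Fin.last n) :=
    (hX.monotone (Fin.zero_le _)).trans_lt (hi.trans_le (hX.monotone (Fin.le_last _)))
  have hd : 0 < X (Fin.last n) - X 0 := sub_pos.2 h
  have h0 : 0 ≤ mu X t := div_nonneg (sub_nonneg.2 ht.1) hd.le
  have h1 : mu X t ≤ 1 := (div_le_one hd).2 (by linarith [ht.2])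
  rw [Lmap_eq h]
  unfold e0 e1
  split_ifs <;> constructor <;> nlinarith

theorem Lmap_sub (i : Fin n) (s t : ℝ) : Lmap X ε i s - Lmap X ε i t = acoef X ε i * (s - t) := by
  unfold Lmap
  ring

theorem F1_eq (i : Fin n) (t y z : ℝ) :
    F1 X Y Z ε p q i t y z
      = p i (Lmap X ε i t) * y + q i (Lmap X ε i t) * z + rmap X Y Z ε p q i t := by
  unfold F1 rmap
  ring

theorem F2_eq (i : Fin n) (t y z : ℝ) :
    F2 X Y Z ε pt qt i t y z
      = pt i (Lmap X ε i t) * y + qt i (Lmap X ε i t) * z + rtmap X Y Z ε pt qt i t := by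
  unfold F2 rtmap
  ring

theorem abs_comp_Lmap_sub_le (hX : StrictMono X) {i : Fin n} {g : ℝ → ℝ} {K : NNReal}
    (hg : LipschitzOnWith K g (Isub X i)) {A : ℝ} (hA : |acoef X ε i| ≤ A) {s t : ℝ}
    (hs : s ∈ Ifull X) (ht : t ∈ Ifull X) :
    |g (Lmap X ε i s) - g (Lmap X ε i t)| ≤ K * (A * |s - t|) := by
  have h := hg.dist_le_mul _ (Lmap_mem_Isub (ε := ε) hX i hs) _ (Lmap_mem_Isub (ε := ε) hX i ht)
  rw [Real.dist_eq, Real.dist_eq, Lmap_sub, abs_mul] at h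
  exact h.trans (by gcongr)

theorem abs_mul_sub_mul_le {a b y z s d U : ℝ} (ha : |a| ≤ s) (hab : |a - b| ≤ d)
    (hz : |z| ≤ U) : |a * y - b * z| ≤ s * |y - z| + d * U := by
  have hd : 0 ≤ d := (abs_nonneg _).trans hab
  calc |a * y - b * z| = |a * (y - z) + (a - b) * z| := by ring_nf
    _ ≤ |a| * |y - z| + |a - b| * |z| := by
        rw [← abs_mul, ← abs_mul]; exact abs_add_le _ _
    _ ≤ _ := by gcongr

/-- Lipschitz estimate for `(t, y, z) ↦ g (L_i t) * y + h (L_i t) * z + r t`. -/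
theorem abs_affine_sub_le (hX : StrictMono X) {i : Fin n} {g h r : ℝ → ℝ} {K K' K'' : NNReal}
    (hg : LipschitzOnWith K g (Isub X i)) (hh : LipschitzOnWith K' h (Isub X i))
    (hr : LipschitzOnWith K'' r (Ifull X)) {A U V : ℝ} (hA : |acoef X ε i| ≤ A)
    {s t y y' z z' : ℝ} (hs : s ∈ Ifull X) (ht : t ∈ Ifull X) (hy : |y'| ≤ U) (hz : |z'| ≤ V) :
    |(g (Lmap X ε i s) * y + h (Lmap X ε i s) * z + r s)
        - (g (Lmap X ε i t) * y' + h (Lmap X ε i t) * z' + r t)|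
      ≤ snormSub X i g * |y - y'| + snormSub X i h * |z - z'|
        + (A * U * K + A * V * K' + K'') * |s - t| := by
  have h1 := abs_mul_sub_mul_le (y := y)
    (abs_le_snormSub hg.continuousOn (Lmap_mem_Isub (ε := ε) hX i hs))
    (abs_comp_Lmap_sub_le hX hg hA hs ht) hy
  have h2 := abs_mul_sub_mul_le (y := z)
    (abs_le_snormSub hh.continuousOn (Lmap_mem_Isub (ε := ε) hX i hs))
    (abs_comp_Lmap_sub_le hX hh hA hs ht) hz
  have h3 := hr.dist_le_mul _ hs _ ht
  rw [Real.dist_eq, Real.dist_eq] at h3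
  rw [abs_le] at h1 h2 h3 ⊢
  constructor <;> linarith [h1.1, h1.2, h2.1, h2.2, h3.1, h3.2]

theorem euclDist_le (P Q : ℝ × ℝ × ℝ) :
    euclDist P Q ≤ |P.1 - Q.1| + |P.2.1 - Q.2.1| + |P.2.2 - Q.2.2| := by
  refine Real.sqrt_le_iff.2 ⟨by positivity, ?_⟩
  rw [← sq_abs (P.1 - Q.1), ← sq_abs (P.2.1 - Q.2.1), ← sq_abs (P.2.2 - Q.2.2)]
  nlinarith [mul_nonneg (abs_nonneg (P.1 - Q.1)) (abs_nonneg (P.2.1 - Q.2.1)),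
    mul_nonneg (abs_nonneg (P.1 - Q.1)) (abs_nonneg (P.2.2 - Q.2.2)),
    mul_nonneg (abs_nonneg (P.2.1 - Q.2.1)) (abs_nonneg (P.2.2 - Q.2.2))]

theorem min_mul_euclDist_le_rho {θ : ℝ} (hθ : 0 < θ) (P Q : ℝ × ℝ × ℝ) :
    min 1 θ * euclDist P Q ≤ rho θ P Q := by
  have h0 : 0 ≤ min 1 θ := by positivity
  have h1 := mul_le_mul_of_nonneg_right (min_le_left 1 θ) (abs_nonneg (P.1 - Q.1))
  have h2 := mul_le_mul_of_nonneg_right (min_le_right 1 θ) (abs_nonneg (P.2.1 - Q.2.1))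
  have h3 := mul_le_mul_of_nonneg_right (min_le_right 1 θ) (abs_nonneg (P.2.2 - Q.2.2))
  have h4 := mul_le_mul_of_nonneg_left (euclDist_le P Q) h0
  unfold rho
  linarith

theorem rho_le_mul_euclDist {θ : ℝ} (hθ : 0 ≤ θ) (P Q : ℝ × ℝ × ℝ) :
    rho θ P Q ≤ (1 + 2 * θ) * euclDist P Q := by
  have h1 : |P.1 - Q.1| ≤ euclDist P Q := Real.abs_le_sqrt (by
    nlinarith [sq_nonneg (P.2.1 - Q.2.1), sq_nonneg (P.2.2 - Q.2.2)])
  have h2 : |P.2.1 - Q.2.1| ≤ euclDist P Q := Real.abs_le_sqrt (by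
    nlinarith [sq_nonneg (P.1 - Q.1), sq_nonneg (P.2.2 - Q.2.2)])
  have h3 : |P.2.2 - Q.2.2| ≤ euclDist P Q := Real.abs_le_sqrt (by
    nlinarith [sq_nonneg (P.1 - Q.1), sq_nonneg (P.2.1 - Q.2.1)])
  have h4 := mul_le_mul_of_nonneg_left (add_le_add h2 h3) hθ
  unfold rho
  linarith

end ZHV

/-- Theorem 1 of the paper. For `0 < θ` below the stated threshold,
the metric `ρ_θ` is Lipschitz-equivalent to the Euclidean metric on `ℝ³` and each
`ω_i : I × E → I × E` is a contraction for `ρ_θ` with ratio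
`κ = max{A + θ(AU(l_p+l_p̃) + AŨ(l_q+l_q̃) + (l_r+l_r̃)), S̄} < 1`. -/
theorem statement0 {n : ℕ} (hn : 0 < n) (X Y Z : Fin (n + 1) → ℝ) (ε : Fin n → Bool)
    (p q pt qt : Fin n → ℝ → ℝ) (hyp : Hyps X p q pt qt)
    (lp lpt lq lqt lr lrt : NNReal)
    (hlp : ∀ i, LipschitzOnWith lp (p i) (Isub X i))
    (hlpt : ∀ i, LipschitzOnWith lpt (pt i) (Isub X i))
    (hlq : ∀ i, LipschitzOnWith lq (q i) (Isub X i))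
    (hlqt : ∀ i, LipschitzOnWith lqt (qt i) (Isub X i))
    (hlr : ∀ i, LipschitzOnWith lr (rmap X Y Z ε p q i) (Ifull X))
    (hlrt : ∀ i, LipschitzOnWith lrt (rtmap X Y Z ε pt qt i) (Ifull X))
    (A : ℝ) (hA : A = ⨆ i : Fin n, |acoef X ε i|)
    (hS : Sbar X p q pt qt < 1)
    (θ : ℝ) (hθ0 : 0 < θ)
    (hθ : θ < (1 - A) /
        (A * Uval X Y Z ε p q pt qt * ((lp : ℝ) + (lpt : ℝ))
          + A * Utval X Y Z ε p q pt qt * ((lq : ℝ) + (lqt : ℝ))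
          + ((lr : ℝ) + (lrt : ℝ))))
    (κ : ℝ)
    (hκ : κ = max
        (A + θ * (A * Uval X Y Z ε p q pt qt * ((lp : ℝ) + (lpt : ℝ))
          + A * Utval X Y Z ε p q pt qt * ((lq : ℝ) + (lqt : ℝ))
          + ((lr : ℝ) + (lrt : ℝ))))
        (Sbar X p q pt qt)) :
    (∃ c₁ c₂ : ℝ, 0 < c₁ ∧ 0 < c₂ ∧ ∀ P Q : ℝ × ℝ × ℝ,
        c₁ * euclDist P Q ≤ rho θ P Q ∧ rho θ P Q ≤ c₂ * euclDist P Q) ∧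
    κ < 1 ∧
    (∀ i : Fin n, ∀ P ∈ Ifull X ×ˢ Eset X Y Z ε p q pt qt,
      ∀ Q ∈ Ifull X ×ˢ Eset X Y Z ε p q pt qt,
        rho θ (wmap X Y Z ε p q pt qt i P) (wmap X Y Z ε p q pt qt i Q) ≤
          κ * rho θ P Q) := by
  have hU : 0 ≤ Uval X Y Z ε p q pt qt := hyp.Uval_nonneg
  have hV : 0 ≤ Utval X Y Z ε p q pt qt := hyp.Utval_nonneg
  have hA0 : 0 ≤ A := hA ▸ Real.iSup_nonneg fun i => abs_nonneg _
  have hAi (i : Fin n) : |acoef X ε i| ≤ A :=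
    hA ▸ le_ciSup (f := fun i => |acoef X ε i|) (finite_range _).bddAbove i
  have hSi (i : Fin n) := le_ciSup (f := fun i : Fin n =>
    max (snormSub X i (p i) + snormSub X i (pt i)) (snormSub X i (q i) + snormSub X i (qt i)))
    (finite_range _).bddAbove i
  change ∀ i : Fin n, _ ≤ Sbar X p q pt qt at hSi
  set U := Uval X Y Z ε p q pt qt
  set V := Utval X Y Z ε p q pt qt
  set D := A * U * ((lp : ℝ) + (lpt : ℝ)) + A * V * ((lq : ℝ) + (lqt : ℝ)) + ((lr : ℝ) + (lrt : ℝ))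
    with hD
  refine ⟨⟨min 1 θ, 1 + 2 * θ, by positivity, by positivity, fun P Q =>
    ⟨min_mul_euclDist_le_rho hθ0 P Q, rho_le_mul_euclDist hθ0.le P Q⟩⟩, ?_, ?_⟩
  · have hD0 : 0 ≤ D := by positivity
    have hDpos : 0 < D := by
      refine hD0.lt_of_ne fun h => ?_
      rw [← h, div_zero] at hθ
      exact hθ.not_gt hθ0
    rw [lt_div_iff₀ hDpos] at hθ
    rw [hκ]
    exact max_lt (by linarith) hS
  · rintro i ⟨s, y, z⟩ ⟨hs, -⟩ ⟨t, y', z'⟩ ⟨ht, hy, hz⟩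
    have h1 := abs_affine_sub_le hyp.1 (hlp i) (hlq i) (hlr i) (hAi i) (y := y) (z := z) hs ht
      (abs_le.2 hy) (abs_le.2 hz)
    have h2 := abs_affine_sub_le hyp.1 (hlpt i) (hlqt i) (hlrt i) (hAi i) (y := y) (z := z) hs ht
      (abs_le.2 hy) (abs_le.2 hz)
    have h3 : A + θ * D ≤ κ := hκ ▸ le_max_left _ _
    have h4 : Sbar X p q pt qt ≤ κ := hκ ▸ le_max_right _ _
    have h5 := ((le_max_left _ _).trans (hSi i)).trans h4
    have h6 := ((le_max_right _ _).trans (hSi i)).trans h4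
    simp only [rho, wmap, F1_eq, F2_eq, Lmap_sub, abs_mul]
    calc _ ≤ A * |s - t| + θ * ((snormSub X i (p i) * |y - y'| + snormSub X i (q i) * |z - z'|
              + (A * U * lp + A * V * lq + lr) * |s - t|)
            + (snormSub X i (pt i) * |y - y'| + snormSub X i (qt i) * |z - z'|
              + (A * U * lpt + A * V * lqt + lrt) * |s - t|)) := by
          gcongr
          exact hAi i
      _ = (A + θ * D) * |s - t| + θ * ((snormSub X i (p i) + snormSub X i (pt i)) * |y - y'|
            + (snormSub X i (q i) + snormSub X i (qt i)) * |z - z'|) := by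
          rw [hD]; ring
      _ ≤ κ * |s - t| + θ * (κ * |y - y'| + κ * |z - z'|) := by gcongr
      _ = κ * (|s - t| + θ * (|y - y'| + |z - z'|)) := by ring
end

section
/- The read-out operator T is well defined from C_0²(I) to itself: for every g = (g_1,g_2) ∈ C_0²(I) the piecewise definition (Tg)(x) = (F_{i,1}(L_i^{-1}(x), g_1(L_i^{-1}(x)), g_2(L_i^{-1}(x))), F_{i,2}(L_i^{-1}(x), g_1(L_i^{-1}(x)), g_2(L_i^{-1}(x)))) for x ∈ I_i is consistent at the interior knots x_1,…,x_{n-1} (the values prescribed on I_i and I_{i+1} agree at x_i and equal (y_i, z_i)), Tg is continuous on I, and (Tg)(x_0) = (y_0,z_0), (Tg)(x_n) = (y_n,z_n). -/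
open Set

open ZHV Set

namespace ZHV

variable {n : ℕ} {X Y Z : Fin (n + 1) → ℝ} {ε : Fin n → Bool}

lemma exists_mem_Isub (hX : StrictMono X) (hn : 0 < n) {t : ℝ} (ht : t ∈ Ifull X) :
    ∃ i, t ∈ Isub X i := by
  have key : ∀ j : Fin (n + 1), t ≤ X j → ∃ i, t ∈ Isub X i := by
    intro j
    induction j using Fin.induction with
    | zero => exact fun h => ⟨⟨0, hn⟩, ht.1, h.trans (hX.monotone (Fin.zero_le _))⟩
    | succ i ih =>
      intro h
      rcases le_total t (X i.castSucc) with h' | h'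
      · exact ih h'
      · exact ⟨i, h', h⟩
  exact key _ ht.2

/-- Distinct subintervals meet only at a common knot, where the pieces agree. -/
lemma eq_of_mem_Isub (hX : StrictMono X) {f : Fin n → ℝ → ℝ} {W : Fin (n + 1) → ℝ}
    (h0 : ∀ i, f i (X i.castSucc) = W i.castSucc) (h1 : ∀ i, f i (X i.succ) = W i.succ)
    {i j : Fin n} {t : ℝ} (hi : t ∈ Isub X i) (hj : t ∈ Isub X j) : f i t = f j t := by
  wlog hij : i ≤ j generalizing i j
  · exact (this hj hi (le_of_not_ge hij)).symm
  rcases hij.eq_or_lt with rfl | hlt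
  · rfl
  have hle : X i.succ ≤ X j.castSucc := hX.monotone (Fin.succ_le_castSucc_iff.2 hlt)
  have hti : t = X i.succ := le_antisymm hi.2 (hle.trans hj.1)
  have htj : t = X j.castSucc := le_antisymm (hi.2.trans hle) hj.1
  have hidx : i.succ = j.castSucc := hX.injective (hti.symm.trans htj)
  calc f i t = W i.succ := by rw [hti, h1]
    _ = W j.castSucc := by rw [hidx]
    _ = f j t := by rw [htj, h0]

lemma exists_glue (hX : StrictMono X) (hn : 0 < n) {f : Fin n → ℝ → ℝ} {W : Fin (n + 1) → ℝ}
    (hf : ∀ i, ContinuousOn (f i) (Isub X i))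
    (h0 : ∀ i, f i (X i.castSucc) = W i.castSucc) (h1 : ∀ i, f i (X i.succ) = W i.succ) :
    ∃ T : ℝ → ℝ, (∀ i, EqOn T (f i) (Isub X i)) ∧ ContinuousOn T (Ifull X) ∧
      ∀ j, T (X j) = W j := by
  classical
  let T : ℝ → ℝ := fun t => if h : ∃ i, t ∈ Isub X i then f h.choose t else 0
  have hT : ∀ i, EqOn T (f i) (Isub X i) := by
    intro i t ht
    have h : ∃ i, t ∈ Isub X i := ⟨i, ht⟩
    simp only [T, dif_pos h]
    exact eq_of_mem_Isub hX h0 h1 h.choose_spec ht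
  refine ⟨T, hT, ?_, ?_⟩
  · have hc : ContinuousOn T (⋃ i, Isub X i) :=
      (locallyFinite_of_finite _).continuousOn_iUnion (fun _ => isClosed_Icc)
        fun i => (hf i).congr (hT i)
    exact hc.mono fun t ht => mem_iUnion.2 (exists_mem_Isub hX hn ht)
  · intro j
    cases j using Fin.cases with
    | zero =>
      have hle := (hX (Fin.castSucc_lt_succ (i := (⟨0, hn⟩ : Fin n)))).le
      exact (hT ⟨0, hn⟩ (left_mem_Icc.2 hle)).trans (h0 ⟨0, hn⟩)
    | succ i =>
      have hle := (hX (Fin.castSucc_lt_succ (i := i))).le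
      exact (hT i (right_mem_Icc.2 hle)).trans (h1 i)

lemma sub_pos_knots (hX : StrictMono X) (i : Fin n) : 0 < X (Fin.last n) - X 0 :=
  sub_pos.2 (hX (i.castSucc.zero_le.trans_lt
    (Fin.castSucc_lt_succ.trans_le i.succ.le_last)))

lemma X_e1_sub_X_e0_ne_zero (hX : StrictMono X) (ε : Fin n → Bool) (i : Fin n) :
    X (e1 ε i) - X (e0 ε i) ≠ 0 := by
  have h := hX (Fin.castSucc_lt_succ (i := i))
  unfold e0 e1
  split_ifs
  · exact (sub_neg.2 h).ne
  · exact (sub_pos.2 h).ne'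

lemma acoef_ne_zero (hX : StrictMono X) (ε : Fin n → Bool) (i : Fin n) : acoef X ε i ≠ 0 :=
  div_ne_zero (X_e1_sub_X_e0_ne_zero hX ε i) (sub_pos_knots hX i).ne'

lemma Lmap_Linv (hX : StrictMono X) (i : Fin n) (t : ℝ) : Lmap X ε i (Linv X ε i t) = t := by
  unfold Lmap Linv
  rw [mul_div_cancel₀ _ (acoef_ne_zero hX ε i), sub_add_cancel]

lemma Linv_X_e0 (hX : StrictMono X) (i : Fin n) : Linv X ε i (X (e0 ε i)) = X 0 := by
  have hD := (sub_pos_knots hX i).ne'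
  rw [Linv, div_eq_iff (acoef_ne_zero hX ε i), acoef, bcoef]
  field_simp
  ring

lemma Linv_X_e1 (hX : StrictMono X) (i : Fin n) :
    Linv X ε i (X (e1 ε i)) = X (Fin.last n) := by
  have hD := (sub_pos_knots hX i).ne'
  rw [Linv, div_eq_iff (acoef_ne_zero hX ε i), acoef, bcoef]
  field_simp
  ring

lemma continuous_Linv (i : Fin n) : Continuous (Linv X ε i) := by
  unfold Linv
  fun_prop

lemma mapsTo_Linv (hX : StrictMono X) (i : Fin n) :
    MapsTo (Linv X ε i) (Isub X i) (Ifull X) := by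
  intro t ht
  have h0 := Linv_X_e0 (ε := ε) hX i
  have h1 := Linv_X_e1 (ε := ε) hX i
  have hD := sub_pos_knots hX i
  have hc := hX (Fin.castSucc_lt_succ (i := i))
  obtain ⟨ht0, ht1⟩ := ht
  unfold Ifull
  rw [← h0, ← h1]
  cases hε : ε i
  · have ha : 0 < acoef X ε i := by
      simpa [acoef, e0, e1, hε] using div_pos (sub_pos.2 hc) hD
    simp only [Linv, e0, e1, hε, Bool.false_eq_true, if_false]
    constructor <;> gcongr
  · have ha : acoef X ε i < 0 := by
      simpa [acoef, e0, e1, hε] using div_neg_of_neg_of_pos (sub_neg.2 hc) hD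
    simp only [Linv, e0, e1, hε, if_true]
    constructor <;> exact div_le_div_of_nonpos_of_le ha.le (by gcongr)

lemma F2_eq_F1 (pt qt : Fin n → ℝ → ℝ) (i : Fin n) (t yv zv : ℝ) :
    F2 X Y Z ε pt qt i t yv zv = F1 X Z Y ε qt pt i t zv yv := by
  unfold F1 F2
  ring

variable {p q : Fin n → ℝ → ℝ} {g1 g2 : ℝ → ℝ}

/-- The first component of the Read operator on `I_i`. -/
noncomputable def readPiece (X Y Z : Fin (n + 1) → ℝ) (ε : Fin n → Bool) (p q : Fin n → ℝ → ℝ)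
    (g1 g2 : ℝ → ℝ) (i : Fin n) (t : ℝ) : ℝ :=
  F1 X Y Z ε p q i (Linv X ε i t) (g1 (Linv X ε i t)) (g2 (Linv X ε i t))

lemma continuousOn_readPiece (hX : StrictMono X) (i : Fin n)
    (hp : ContinuousOn (p i) (Isub X i)) (hq : ContinuousOn (q i) (Isub X i))
    (hg1 : ContinuousOn g1 (Ifull X)) (hg2 : ContinuousOn g2 (Ifull X)) :
    ContinuousOn (readPiece X Y Z ε p q g1 g2 i) (Isub X i) := by
  have hL : ContinuousOn (Linv X ε i) (Isub X i) := (continuous_Linv i).continuousOn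
  have h1 : ContinuousOn (fun t => g1 (Linv X ε i t)) (Isub X i) :=
    hg1.comp hL (mapsTo_Linv hX i)
  have h2 : ContinuousOn (fun t => g2 (Linv X ε i t)) (Isub X i) :=
    hg2.comp hL (mapsTo_Linv hX i)
  unfold readPiece F1 base mu
  simp only [Lmap_Linv hX]
  refine ((hp.mul (h1.sub ?_)).add (hq.mul (h2.sub ?_))).add ?_ <;> fun_prop

lemma readPiece_X_e0 (hX : StrictMono X) (i : Fin n) (h1 : g1 (X 0) = Y 0)
    (h2 : g2 (X 0) = Z 0) : readPiece X Y Z ε p q g1 g2 i (X (e0 ε i)) = Y (e0 ε i) := by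
  simp [readPiece, F1, base, mu, Linv_X_e0 hX, h1, h2]

lemma readPiece_X_e1 (hX : StrictMono X) (i : Fin n)
    (h1 : g1 (X (Fin.last n)) = Y (Fin.last n)) (h2 : g2 (X (Fin.last n)) = Z (Fin.last n)) :
    readPiece X Y Z ε p q g1 g2 i (X (e1 ε i)) = Y (e1 ε i) := by
  simp [readPiece, F1, base, mu, Linv_X_e1 hX, h1, h2, div_self (sub_pos_knots hX i).ne']

lemma exists_read (hX : StrictMono X) (hn : 0 < n)
    (hp : ∀ i, ContinuousOn (p i) (Isub X i)) (hq : ∀ i, ContinuousOn (q i) (Isub X i))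
    (hg1 : ContinuousOn g1 (Ifull X)) (hg2 : ContinuousOn g2 (Ifull X))
    (hg10 : g1 (X 0) = Y 0) (hg20 : g2 (X 0) = Z 0)
    (hg1n : g1 (X (Fin.last n)) = Y (Fin.last n))
    (hg2n : g2 (X (Fin.last n)) = Z (Fin.last n)) :
    ∃ T : ℝ → ℝ, (∀ i, EqOn T (readPiece X Y Z ε p q g1 g2 i) (Isub X i)) ∧
      ContinuousOn T (Ifull X) ∧ ∀ j, T (X j) = Y j := by
  have h0 := fun i => readPiece_X_e0 (ε := ε) (p := p) (q := q) hX i hg10 hg20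
  have h1 := fun i => readPiece_X_e1 (ε := ε) (p := p) (q := q) hX i hg1n hg2n
  refine exists_glue hX hn
    (fun i => continuousOn_readPiece hX i (hp i) (hq i) hg1 hg2) (fun i => ?_) fun i => ?_
  · cases hε : ε i
    · simpa [e0, hε] using h0 i
    · simpa [e1, hε] using h1 i
  · cases hε : ε i
    · simpa [e1, hε] using h1 i
    · simpa [e0, hε] using h0 i

end ZHV

/-- The operator `T` is well defined from `C₀²(I)` to itself: the
piecewise prescription is consistent at the knots (there is a single function realizing
it on every `I_i`), the result is continuous on `I`, takes the value `(y_j, z_j)` at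
every knot `x_j`, and in particular has the required endpoint values. -/
theorem statement5 {n : ℕ} (hn : 0 < n) (X Y Z : Fin (n + 1) → ℝ) (ε : Fin n → Bool)
    (p q pt qt : Fin n → ℝ → ℝ) (hyp : Hyps X p q pt qt)
    (g1 g2 : ℝ → ℝ)
    (hg1 : ContinuousOn g1 (Ifull X)) (hg2 : ContinuousOn g2 (Ifull X))
    (hg10 : g1 (X 0) = Y 0) (hg20 : g2 (X 0) = Z 0)
    (hg1n : g1 (X (Fin.last n)) = Y (Fin.last n))
    (hg2n : g2 (X (Fin.last n)) = Z (Fin.last n)) :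
    ∃ T1 T2 : ℝ → ℝ,
      (∀ i : Fin n, ∀ t ∈ Isub X i,
        T1 t = F1 X Y Z ε p q i (Linv X ε i t)
            (g1 (Linv X ε i t)) (g2 (Linv X ε i t)) ∧
        T2 t = F2 X Y Z ε pt qt i (Linv X ε i t)
            (g1 (Linv X ε i t)) (g2 (Linv X ε i t))) ∧
      ContinuousOn T1 (Ifull X) ∧ ContinuousOn T2 (Ifull X) ∧
      (∀ j : Fin (n + 1), T1 (X j) = Y j ∧ T2 (X j) = Z j) := by
  obtain ⟨hX, hp, hpt, hq, hqt, -, -⟩ := hyp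
  have cont {r : Fin n → ℝ → ℝ} (hr : ∀ i, ∃ K : NNReal, LipschitzOnWith K (r i) (Isub X i))
      (i : Fin n) : ContinuousOn (r i) (Isub X i) := (hr i).choose_spec.continuousOn
  obtain ⟨T1, hT1, hc1, hk1⟩ := exists_read (ε := ε) hX hn (cont hp) (cont hq)
    hg1 hg2 hg10 hg20 hg1n hg2n
  obtain ⟨T2, hT2, hc2, hk2⟩ := exists_read (ε := ε) hX hn (cont hqt) (cont hpt)
    hg2 hg1 hg20 hg10 hg2n hg1n
  refine ⟨T1, T2, fun i t ht => ⟨hT1 i ht, ?_⟩, hc1, hc2, fun j => ⟨hk1 j, hk2 j⟩⟩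
  rw [F2_eq_F1]
  exact hT2 i ht
end

section
/- Fix i ∈ {1,…,n} and suppose p_i(x) ≥ 0 and q_i(x) ≥ 0 for all x ∈ I_i. If p_i^max ≤ min{(min{y_{i-1},y_i} - k_1)/(max{y_0,y_n} - k_1), (k_2 - max{y_{i-1},y_i})/(k_2 - min{y_0,y_n})} and q_i^max ≤ min{[(min{y_{i-1},y_i} - k_1) - p_i^max(max{y_0,y_n} - k_1)]/(max{z_0,z_n} - k̃_1), [(k_2 - max{y_{i-1},y_i}) - p_i^max(k_2 - min{y_0,y_n})]/(k̃_2 - min{z_0,z_n})}, then k_1 ≤ F_{i,1}(x,y,z) ≤ k_2 for every (x,y,z) ∈ I × [k_1,k_2] × [k̃_1,k̃_2]. -/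
open Set

open ZHV Set

/-- A convex combination of two reals lies between their minimum and their maximum. -/
lemma convex_comb_mem_Icc_min_max {m : ℝ} (hm : m ∈ Icc (0 : ℝ) 1) (a b : ℝ) :
    m * b + (1 - m) * a ∈ Icc (min a b) (max a b) := by
  obtain ⟨h0, h1⟩ := hm
  constructor
  · nlinarith [mul_le_mul_of_nonneg_left (min_le_right a b) h0,
      mul_le_mul_of_nonneg_left (min_le_left a b) (sub_nonneg.2 h1)]
  · nlinarith [mul_le_mul_of_nonneg_left (le_max_right a b) h0,
      mul_le_mul_of_nonneg_left (le_max_left a b) (sub_nonneg.2 h1)]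

/-- If `0 ≤ g ≤ M ≤ c / d` with `d > 0`, then `g * u ≤ c` for every `u ≤ d`. -/
lemma mul_le_of_le_div {g M c d u : ℝ} (hg : 0 ≤ g) (hgM : g ≤ M) (hd : 0 < d)
    (hM : M ≤ c / d) (hu : u ≤ d) : g * u ≤ c :=
  calc g * u ≤ g * d := mul_le_mul_of_nonneg_left hu hg
    _ ≤ M * d := mul_le_mul_of_nonneg_right hgM hd.le
    _ ≤ c := (le_div_iff₀ hd).1 hM

lemma le_fmax {n : ℕ} {X : Fin (n + 1) → ℝ} {i : Fin n} {g : ℝ → ℝ}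
    (hg : ContinuousOn g (Isub X i)) {s : ℝ} (hs : s ∈ Isub X i) : g s ≤ fmax X i g :=
  le_csSup (isCompact_Icc.image_of_continuousOn hg).bddAbove (mem_image_of_mem g hs)

lemma mu_mem_Icc {n : ℕ} {X : Fin (n + 1) → ℝ} (hX : X 0 < X (Fin.last n)) {t : ℝ}
    (ht : t ∈ Ifull X) : mu X t ∈ Icc (0 : ℝ) 1 := by
  have hd := sub_pos.2 hX
  exact ⟨div_nonneg (sub_nonneg.2 ht.1) hd.le,
    (div_le_one hd).2 (sub_le_sub_right ht.2 _)⟩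

lemma Lmap_eq_convex_comb {n : ℕ} {X : Fin (n + 1) → ℝ} (hX : X 0 < X (Fin.last n))
    (ε : Fin n → Bool) (i : Fin n) (t : ℝ) :
    Lmap X ε i t = mu X t * X (e1 ε i) + (1 - mu X t) * X (e0 ε i) := by
  have hd := (sub_pos.2 hX).ne'
  unfold Lmap mu acoef bcoef
  field_simp
  ring

lemma convex_comb_e0_e1_mem {n : ℕ} (W : Fin (n + 1) → ℝ) (ε : Fin n → Bool) (i : Fin n)
    {m : ℝ} (hm : m ∈ Icc (0 : ℝ) 1) :
    m * W (e1 ε i) + (1 - m) * W (e0 ε i) ∈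
      Icc (min (W i.castSucc) (W i.succ)) (max (W i.castSucc) (W i.succ)) := by
  have h := convex_comb_mem_Icc_min_max hm (W (e0 ε i)) (W (e1 ε i))
  cases hε : ε i
  · simpa [e0, e1, hε] using h
  · simpa [e0, e1, hε, min_comm, max_comm] using h

lemma Lmap_mem_Isub {n : ℕ} {X : Fin (n + 1) → ℝ} (hX : StrictMono X)
    (h0n : X 0 < X (Fin.last n)) (ε : Fin n → Bool) (i : Fin n) {t : ℝ} (ht : t ∈ Ifull X) :
    Lmap X ε i t ∈ Isub X i := by
  have hle : X i.castSucc ≤ X i.succ := (hX i.castSucc_lt_succ).le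
  have h := convex_comb_e0_e1_mem X ε i (mu_mem_Icc h0n ht)
  rw [min_eq_left hle, max_eq_right hle] at h
  rwa [Lmap_eq_convex_comb h0n]

/-- Case 1 of Theorem 3. If `p_i, q_i ≥ 0` on `I_i` and `p_i^max`,
`q_i^max` satisfy the stated bounds, then `k₁ ≤ F_{i,1}(x,y,z) ≤ k₂` on
`I × [k₁,k₂] × [k̃₁,k̃₂]`. -/
theorem statement10 {n : ℕ} (hn : 0 < n) (X Y Z : Fin (n + 1) → ℝ) (ε : Fin n → Bool)
    (p q pt qt : Fin n → ℝ → ℝ) (hyp : Hyps X p q pt qt)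
    (k1 k2 kt1 kt2 : ℝ)
    (hk1 : ∀ j, k1 < Y j) (hk2 : ∀ j, Y j < k2)
    (hkt1 : ∀ j, kt1 < Z j) (hkt2 : ∀ j, Z j < kt2)
    (i : Fin n)
    (hsign : ∀ t ∈ Isub X i, 0 ≤ p i t ∧ 0 ≤ q i t)
    (hp : fmax X i (p i) ≤ min
      ((min (Y i.castSucc) (Y i.succ) - k1) / (max (Y 0) (Y (Fin.last n)) - k1))
      ((k2 - max (Y i.castSucc) (Y i.succ)) / (k2 - min (Y 0) (Y (Fin.last n)))))
    (hq : fmax X i (q i) ≤ min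
      (((min (Y i.castSucc) (Y i.succ) - k1)
          - fmax X i (p i) * (max (Y 0) (Y (Fin.last n)) - k1)) /
        (max (Z 0) (Z (Fin.last n)) - kt1))
      (((k2 - max (Y i.castSucc) (Y i.succ))
          - fmax X i (p i) * (k2 - min (Y 0) (Y (Fin.last n)))) /
        (kt2 - min (Z 0) (Z (Fin.last n))))) :
    ∀ t ∈ Ifull X, ∀ yv ∈ Icc k1 k2, ∀ zv ∈ Icc kt1 kt2,
      F1 X Y Z ε p q i t yv zv ∈ Icc k1 k2 := by
  obtain ⟨hX, hpL, -, hqL, -⟩ := hyp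
  have h0n : X 0 < X (Fin.last n) := hX (Fin.pos_iff_ne_zero.2 (by simp [hn.ne']))
  intro t ht yv hy zv hz
  have hL := Lmap_mem_Isub hX h0n ε i ht
  have hm := mu_mem_Icc h0n ht
  obtain ⟨Kp, hKp⟩ := hpL i
  obtain ⟨Kq, hKq⟩ := hqL i
  have hpM := le_fmax hKp.continuousOn hL
  have hqM := le_fmax hKq.continuousOn hL
  obtain ⟨hp0, hq0⟩ := hsign _ hL
  have hbY : base X Y t ∈ Icc _ _ := convex_comb_mem_Icc_min_max hm (Y 0) (Y (Fin.last n))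
  have hbZ : base X Z t ∈ Icc _ _ := convex_comb_mem_Icc_min_max hm (Z 0) (Z (Fin.last n))
  have hbase := convex_comb_e0_e1_mem Y ε i hm
  have hYl : 0 < max (Y 0) (Y (Fin.last n)) - k1 := sub_pos.2 (lt_max_of_lt_left (hk1 0))
  have hYu : 0 < k2 - min (Y 0) (Y (Fin.last n)) := sub_pos.2 (min_lt_of_left_lt (hk2 0))
  have hZl : 0 < max (Z 0) (Z (Fin.last n)) - kt1 := sub_pos.2 (lt_max_of_lt_left (hkt1 0))
  have hZu : 0 < kt2 - min (Z 0) (Z (Fin.last n)) := sub_pos.2 (min_lt_of_left_lt (hkt2 0))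
  have hql := mul_le_of_le_div hq0 hqM hZl (hq.trans (min_le_left _ _))
    (sub_le_sub hbZ.2 hz.1)
  have hqu := mul_le_of_le_div hq0 hqM hZu (hq.trans (min_le_right _ _))
    (sub_le_sub hz.2 hbZ.1)
  have hpl := mul_le_mul_of_nonneg_left (sub_le_sub hbY.2 hy.1) hp0
  have hpu := mul_le_mul_of_nonneg_left (sub_le_sub hy.2 hbY.1) hp0
  have hpl' := mul_le_mul_of_nonneg_right hpM hYl.le
  have hpu' := mul_le_mul_of_nonneg_right hpM hYu.le
  unfold F1
  constructor
  · linarith [hbase.1]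
  · linarith [hbase.2]
end
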